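/- arXiv:2412.01731 — 8 statements merged into one kernel-verified Lean document; each statement's English description precedes it below -/
import Mathlib

section
/- Let n ≥ 1 and let P be an n×n real row-stochastic matrix in type-B form. If Π is a stationary distribution of P, then Π j = α j · Π 0 for every state j, where α is the recursively defined vector with α 0 = 1 and α j = Σ_{i < j} α i · P i j for j ≠ 0. -/
/-- Let `n ≥ 1` and let `P` be an `n×n` real row-stochastic matrix in
type-B form (every positive transition goes either to state `0` or to a strictly
larger-indexed state).  If `π` is a stationary distribution of `P`, then
`π j = α j * π 0` for every state `j`, where `α` is the recursively defined vector with
`α 0 = 1` and `α j = ∑_{i < j} α i * P i j` for `j ≠ 0`. -/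
theorem typeB_stationary_eq_alpha_mul
    (n : ℕ) [NeZero n] (P : Matrix (Fin n) (Fin n) ℝ)
    (hP_nonneg : ∀ i j, 0 ≤ P i j)
    (hP_row : ∀ i, ∑ j, P i j = 1)
    (hP_typeB : ∀ i j : Fin n, j ≠ 0 → j ≤ i → P i j = 0)
    (α : Fin n → ℝ)
    (hα0 : α 0 = 1)
    (hα : ∀ j : Fin n, j ≠ 0 →
      α j = ∑ i ∈ Finset.univ.filter (fun i => i < j), α i * P i j)
    (π : Fin n → ℝ)
    (hπ_nonneg : ∀ j, 0 ≤ π j)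
    (hπ_sum : ∑ j, π j = 1)
    (hπ_stat : ∀ j, ∑ i, π i * P i j = π j) :
    ∀ j, π j = α j * π 0 := by
  intro j
  induction j using WellFoundedLT.induction with
  | ind j ih =>
    by_cases hj : j = 0
    · subst hj
      rw [hα0, one_mul]
    · rw [hα j hj, ← hπ_stat j, Finset.sum_mul, Finset.sum_filter]
      refine Finset.sum_congr rfl fun i _ => ?_
      split_ifs with h
      · rw [ih i h]
        ring
      · rw [hP_typeB i j hj (not_lt.mp h), mul_zero]
end

section
/- Let n ≥ 1 and let P be an n×n real row-stochastic matrix in type-B form. If Π is a stationary distribution of P, then Π 0 · (Σ_{j} α j) = 1, i.e., Π 0 = (1 + Σ_{j ≠ 0} α j)⁻¹, where α is the recursively defined vector with α 0 = 1 and α j = Σ_{i < j} α i · P i j for j ≠ 0. -/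
/-- Let `n ≥ 1` and let `P` be an `n×n` real row-stochastic matrix in
type-B form.  If `π` is a stationary distribution of `P`, then `π 0 * (∑ j, α j) = 1`,
i.e. `π 0 = (1 + ∑_{j ≠ 0} α j)⁻¹`, where `α` is the recursively defined vector with
`α 0 = 1` and `α j = ∑_{i < j} α i * P i j` for `j ≠ 0`. -/
theorem typeB_stationary_root_value
    (n : ℕ) [NeZero n] (P : Matrix (Fin n) (Fin n) ℝ)
    (hP_nonneg : ∀ i j, 0 ≤ P i j)
    (hP_row : ∀ i, ∑ j, P i j = 1)
    (hP_typeB : ∀ i j : Fin n, j ≠ 0 → j ≤ i → P i j = 0)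
    (α : Fin n → ℝ)
    (hα0 : α 0 = 1)
    (hα : ∀ j : Fin n, j ≠ 0 →
      α j = ∑ i ∈ Finset.univ.filter (fun i => i < j), α i * P i j)
    (π : Fin n → ℝ)
    (hπ_nonneg : ∀ j, 0 ≤ π j)
    (hπ_sum : ∑ j, π j = 1)
    (hπ_stat : ∀ j, ∑ i, π i * P i j = π j) :
    π 0 * (∑ j, α j) = 1 ∧
      π 0 = (1 + ∑ j ∈ Finset.univ.filter (fun j => j ≠ 0), α j)⁻¹ := by
  have key : ∀ j : Fin n, π j = π 0 * α j := by
    intro j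
    induction j using WellFoundedLT.induction with
    | ind j ih =>
      by_cases hj : j = 0
      · subst hj
        rw [hα0, mul_one]
      · rw [hα j hj, Finset.mul_sum, ← hπ_stat j, Finset.sum_filter]
        refine Finset.sum_congr rfl fun i _ => ?_
        split_ifs with h
        · rw [ih i h, mul_assoc]
        · rw [hP_typeB i j hj (not_lt.mp h), mul_zero]
  have h1 : π 0 * (∑ j, α j) = 1 := by
    rw [Finset.mul_sum, ← hπ_sum]
    exact Finset.sum_congr rfl fun j _ => (key j).symm
  refine ⟨h1, ?_⟩
  have h2 : (1 + ∑ j ∈ Finset.univ.filter (fun j => j ≠ 0), α j) = ∑ j, α j := by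
    rw [Finset.filter_ne', ← hα0]
    exact Finset.add_sum_erase _ _ (Finset.mem_univ _)
  rw [h2]
  exact eq_inv_of_mul_eq_one_left h1
end

section
/- Let n ≥ 1 and let P be an n×n real row-stochastic matrix in type-B form. Then every stationary distribution Π of P satisfies Π 0 > 0. -/
/-- Let `n ≥ 1` and let `P` be an `n×n` real row-stochastic matrix in
type-B form.  Then every stationary distribution `π` of `P` satisfies `π 0 > 0`. -/
theorem typeB_stationary_root_pos
    (n : ℕ) [NeZero n] (P : Matrix (Fin n) (Fin n) ℝ)
    (hP_nonneg : ∀ i j, 0 ≤ P i j)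
    (hP_row : ∀ i, ∑ j, P i j = 1)
    (hP_typeB : ∀ i j : Fin n, j ≠ 0 → j ≤ i → P i j = 0)
    (π : Fin n → ℝ)
    (hπ_nonneg : ∀ j, 0 ≤ π j)
    (hπ_sum : ∑ j, π j = 1)
    (hπ_stat : ∀ j, ∑ i, π i * P i j = π j) :
    0 < π 0 := by
  by_contra hneg
  have h0 : π 0 = 0 := le_antisymm (not_lt.mp hneg) (hπ_nonneg 0)
  have key : ∀ m : ℕ, ∀ j : Fin n, j.val = m → π j = 0 := by
    intro m
    induction m using Nat.strong_induction_on with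
    | _ m ih =>
      intro j hj
      by_cases hj0 : j = 0
      · rw [hj0, h0]
      · rw [← hπ_stat j]
        apply Finset.sum_eq_zero
        intro i _
        rcases le_or_gt j i with h | h
        · rw [hP_typeB i j hj0 h, mul_zero]
        · have hlt : i.val < m := by
            rw [← hj]
            exact h
          rw [ih i.val hlt i rfl, zero_mul]
  have hs : ∑ j, π j = 0 := Finset.sum_eq_zero fun j _ => key j.val j rfl
  rw [hs] at hπ_sum
  exact zero_ne_one hπ_sum
end

section
/- Let n ≥ 1 and let P be an n×n real row-stochastic matrix in type-B form, and let α be the recursively defined vector with α 0 = 1 and α j = Σ_{i < j} α i · P i j for j ≠ 0. Then Σ_j α j > 0, and the vector Π defined by Π j = α j / (Σ_i α i) is a stationary distribution of P (its entries are nonnegative, it sums to 1, and Σ_i Π i · P i j = Π j for every j, including the balance equation at state 0). -/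
/-- Let `n ≥ 1`, let `P` be an `n×n` real row-stochastic matrix in
type-B form, and let `α` be the recursively defined vector with `α 0 = 1` and
`α j = ∑_{i < j} α i * P i j` for `j ≠ 0`.  Then `∑ j, α j > 0`, and the vector
`π` defined by `π j = α j / (∑ i, α i)` is a stationary distribution of `P`:
its entries are nonnegative, it sums to `1`, and `∑ i, π i * P i j = π j` for
every `j` (including the balance equation at state `0`). -/
theorem typeB_alpha_normalized_is_stationary
    (n : ℕ) [NeZero n] (P : Matrix (Fin n) (Fin n) ℝ)
    (hP_nonneg : ∀ i j, 0 ≤ P i j)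
    (hP_row : ∀ i, ∑ j, P i j = 1)
    (hP_typeB : ∀ i j : Fin n, j ≠ 0 → j ≤ i → P i j = 0)
    (α : Fin n → ℝ)
    (hα0 : α 0 = 1)
    (hα : ∀ j : Fin n, j ≠ 0 →
      α j = ∑ i ∈ Finset.univ.filter (fun i => i < j), α i * P i j) :
    0 < (∑ j, α j) ∧
      (∀ j, 0 ≤ α j / (∑ i, α i)) ∧
      (∑ j, α j / (∑ i, α i)) = 1 ∧
      (∀ j, ∑ i, (α i / (∑ i', α i')) * P i j = α j / (∑ i', α i')) := by
  have hnn : ∀ j, 0 ≤ α j := by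
    intro j
    induction j using WellFoundedLT.induction with
    | ind j ih =>
      by_cases hj : j = 0
      · rw [hj, hα0]; exact zero_le_one
      · rw [hα j hj]
        refine Finset.sum_nonneg fun i hi => ?_
        exact mul_nonneg (ih i (Finset.mem_filter.mp hi).2) (hP_nonneg i j)
  have hpos : 0 < ∑ j, α j := by
    have h := Finset.single_le_sum (fun i _ => hnn i) (Finset.mem_univ (0 : Fin n))
    rw [hα0] at h
    linarith
  have hne : ∀ j, j ≠ 0 → ∑ i, α i * P i j = α j := by
    intro j hj
    rw [hα j hj, Finset.sum_filter]
    refine Finset.sum_congr rfl fun i _ => ?_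
    split_ifs with h
    · rfl
    · rw [hP_typeB i j hj (not_lt.mp h), mul_zero]
  have htot : ∑ j, ∑ i, α i * P i j = ∑ j, α j := by
    rw [Finset.sum_comm]
    refine Finset.sum_congr rfl fun i _ => ?_
    rw [← Finset.mul_sum, hP_row, mul_one]
  have hbal : ∀ j, ∑ i, α i * P i j = α j := by
    intro j
    by_cases hj : j = 0
    · subst hj
      rw [← Finset.add_sum_erase _ _ (Finset.mem_univ (0 : Fin n)),
        ← Finset.add_sum_erase _ α (Finset.mem_univ (0 : Fin n)),
        Finset.sum_congr rfl fun j hj => hne j (Finset.ne_of_mem_erase hj)] at htot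
      exact add_right_cancel htot
    · exact hne j hj
  refine ⟨hpos, fun j => div_nonneg (hnn j) hpos.le, ?_, fun j => ?_⟩
  · rw [← Finset.sum_div, div_self hpos.ne']
  · simp_rw [div_mul_eq_mul_div]
    rw [← Finset.sum_div, hbal j]
end

section
/- Let n ≥ 1 and let P be an n×n real row-stochastic matrix in type-B form. Then P has at most one stationary distribution: if Π and Π' are both stationary distributions of P, then Π = Π'. -/
theorem typeB_aux
    (n : ℕ) [NeZero n] (P : Matrix (Fin n) (Fin n) ℝ)
    (hB : ∀ i j : Fin n, j ≠ 0 → j ≤ i → P i j = 0)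
    (v : Fin n → ℝ) (hv : ∀ j, ∑ i, v i * P i j = v j) (h0 : v 0 = 0) (j : Fin n) :
    v j = 0 := by
  induction j using WellFoundedLT.induction with
  | ind j ih =>
    by_cases hj : j = 0
    · rw [hj, h0]
    · rw [← hv j]
      refine Finset.sum_eq_zero fun i _ => ?_
      rcases lt_or_ge i j with h | h
      · rw [ih i h, zero_mul]
      · rw [hB i j hj h, mul_zero]

/-- Let `n ≥ 1` and let `P` be an `n×n` real row-stochastic matrix in
type-B form.  Then `P` has at most one stationary distribution: if `π` and `π'` are both
stationary distributions of `P`, then `π = π'`. -/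
theorem typeB_stationary_unique
    (n : ℕ) [NeZero n] (P : Matrix (Fin n) (Fin n) ℝ)
    (hP_nonneg : ∀ i j, 0 ≤ P i j)
    (hP_row : ∀ i, ∑ j, P i j = 1)
    (hP_typeB : ∀ i j : Fin n, j ≠ 0 → j ≤ i → P i j = 0)
    (π π' : Fin n → ℝ)
    (hπ_nonneg : ∀ j, 0 ≤ π j)
    (hπ_sum : ∑ j, π j = 1)
    (hπ_stat : ∀ j, ∑ i, π i * P i j = π j)
    (hπ'_nonneg : ∀ j, 0 ≤ π' j)
    (hπ'_sum : ∑ j, π' j = 1)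
    (hπ'_stat : ∀ j, ∑ i, π' i * P i j = π' j) :
    π = π' := by
  have key : π' 0 = π 0 := by
    have h := typeB_aux n P hP_typeB (fun j => π' 0 * π j - π 0 * π' j)
      (fun j => by
        simp only [sub_mul, Finset.sum_sub_distrib, mul_assoc, ← Finset.mul_sum,
          hπ_stat, hπ'_stat]) (by ring)
    have h2 : ∑ j, (π' 0 * π j - π 0 * π' j) = 0 := Finset.sum_eq_zero fun j _ => h j
    rw [Finset.sum_sub_distrib, ← Finset.mul_sum, ← Finset.mul_sum, hπ_sum, hπ'_sum] at h2
    linarith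
  funext j
  have h := typeB_aux n P hP_typeB (fun j => π j - π' j)
    (fun j => by
      simp only [sub_mul, Finset.sum_sub_distrib, hπ_stat, hπ'_stat])
    (by simp [key]) j
  exact sub_eq_zero.mp h
end

section
/- Let n ≥ 1 and let P be an n×n real matrix in type-B form. If W : Fin n → ℝ satisfies W 0 = 0 and W s = Σ_{s'} P s s' · W s' for every s, then W = 0. -/
/-- Let `n ≥ 1` and let `P` be an `n×n` real matrix in type-B form.
If `W : Fin n → ℝ` satisfies `W 0 = 0` and `W s = ∑ s', P s s' * W s'` for every `s`,
then `W = 0`. -/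
theorem typeB_harmonic_vanishing
    (n : ℕ) [NeZero n] (P : Matrix (Fin n) (Fin n) ℝ)
    (hP_typeB : ∀ i j : Fin n, j ≠ 0 → j ≤ i → P i j = 0)
    (W : Fin n → ℝ)
    (hW0 : W 0 = 0)
    (hW : ∀ s, W s = ∑ s', P s s' * W s') :
    W = 0 := by
  funext s
  induction s using WellFoundedGT.induction with
  | ind s ih =>
    rw [hW s]
    apply Finset.sum_eq_zero
    intro j _
    by_cases hj : j = 0
    · rw [hj, hW0, mul_zero]
    · rcases le_or_gt j s with h | h
      · rw [hP_typeB s j hj h, zero_mul]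
      · rw [ih j h, Pi.zero_apply, mul_zero]
end

section
/- Let n ≥ 1, let P be an n×n real row-stochastic matrix in type-B form, and let R : Fin n → ℝ. If (V, ρ) and (V', ρ') are two pairs such that V and V' satisfy the Bellman evaluation system for (P, R, ρ) and (P, R, ρ') respectively and V 0 = V' 0 = 0, then ρ = ρ' and V = V'. -/
/-- Let `n ≥ 1`, let `P` be an `n×n` real row-stochastic matrix in
type-B form, and let `R : Fin n → ℝ`.  If `(V, ρ)` and `(V', ρ')` are two pairs such
that `V` and `V'` satisfy the Bellman evaluation system for `(P, R, ρ)` and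
`(P, R, ρ')` respectively and `V 0 = V' 0 = 0`, then `ρ = ρ'` and `V = V'`. -/
theorem bellman_typeB_solution_unique
    (n : ℕ) [NeZero n] (P : Matrix (Fin n) (Fin n) ℝ)
    (hP_nonneg : ∀ i j, 0 ≤ P i j)
    (hP_row : ∀ i, ∑ j, P i j = 1)
    (hP_typeB : ∀ i j : Fin n, j ≠ 0 → j ≤ i → P i j = 0)
    (R : Fin n → ℝ) (V V' : Fin n → ℝ) (ρ ρ' : ℝ)
    (hV : ∀ s, V s = R s - ρ + ∑ s', P s s' * V s')
    (hV' : ∀ s, V' s = R s - ρ' + ∑ s', P s s' * V' s')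
    (hV0 : V 0 = 0) (hV'0 : V' 0 = 0) :
    ρ = ρ' ∧ V = V' := by
  have hD : ∀ s, V s - V' s = (ρ' - ρ) + ∑ j, P s j * (V j - V' j) := by
    intro s
    have h : ∑ j, P s j * (V j - V' j) = ∑ j, P s j * V j - ∑ j, P s j * V' j := by
      simp only [mul_sub, Finset.sum_sub_distrib]
    rw [h]
    linarith [hV s, hV' s]
  have hconst : ∀ s (c : ℝ), ∑ j, P s j * c = c := by
    intro s c
    rw [← Finset.sum_mul, hP_row, one_mul]
  have hρ : ρ = ρ' := by
    obtain ⟨a, ha⟩ := Finite.exists_max (fun s => V s - V' s)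
    obtain ⟨b, hb⟩ := Finite.exists_min (fun s => V s - V' s)
    have h1 : ∑ j, P a j * (V j - V' j) ≤ ∑ j, P a j * (V a - V' a) :=
      Finset.sum_le_sum fun j _ => mul_le_mul_of_nonneg_left (ha j) (hP_nonneg a j)
    have h2 : ∑ j, P b j * (V b - V' b) ≤ ∑ j, P b j * (V j - V' j) :=
      Finset.sum_le_sum fun j _ => mul_le_mul_of_nonneg_left (hb j) (hP_nonneg b j)
    rw [hconst] at h1 h2
    linarith [hD a, hD b]
  refine ⟨hρ, ?_⟩
  have key : ∀ s : Fin n, V s - V' s = 0 := by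
    intro s
    induction s using WellFoundedGT.induction with
    | ind s ih =>
      rw [hD s, hρ, sub_self, zero_add]
      refine Finset.sum_eq_zero fun j _ => ?_
      by_cases hj : j = 0
      · rw [hj, hV0, hV'0]; simp
      · rcases le_or_gt j s with h | h
        · rw [hP_typeB s j hj h, zero_mul]
        · rw [ih j h, mul_zero]
  funext s
  linarith [key s]
end

section
/- Let n ≥ 1, let P be an n×n real row-stochastic matrix in type-B form, let Π be a stationary distribution of P, let R : Fin n → ℝ, and set ρ = Σ_s Π s · R s. Then there exists a vector V : Fin n → ℝ with V 0 = 0 that satisfies the Bellman evaluation system for (P, R, ρ), i.e., V s = R s − ρ + Σ_{s'} P s s' · V s' for every state s (including state 0). -/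
/-- Let `n ≥ 1`, let `P` be an `n×n` real row-stochastic matrix in
type-B form, let `π` be a stationary distribution of `P`, let `R : Fin n → ℝ`, and set
`ρ = ∑ s, π s * R s`.  Then there exists a vector `V : Fin n → ℝ` with `V 0 = 0` that
satisfies the Bellman evaluation system for `(P, R, ρ)`, i.e.
`V s = R s - ρ + ∑ s', P s s' * V s'` for every state `s` (including state `0`). -/
theorem bellman_typeB_solution_exists
    (n : ℕ) [NeZero n] (P : Matrix (Fin n) (Fin n) ℝ)
    (hP_nonneg : ∀ i j, 0 ≤ P i j)
    (hP_row : ∀ i, ∑ j, P i j = 1)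
    (hP_typeB : ∀ i j : Fin n, j ≠ 0 → j ≤ i → P i j = 0)
    (π : Fin n → ℝ)
    (hπ_nonneg : ∀ j, 0 ≤ π j)
    (hπ_sum : ∑ j, π j = 1)
    (hπ_stat : ∀ j, ∑ i, π i * P i j = π j)
    (R : Fin n → ℝ) (ρ : ℝ) (hρ : ρ = ∑ s, π s * R s) :
    ∃ V : Fin n → ℝ, V 0 = 0 ∧ ∀ s, V s = R s - ρ + ∑ s', P s s' * V s' := by
  have hW : ∃ W : Fin n → ℝ, ∀ s, W s = R s - ρ + ∑ s', if s < s' then P s s' * W s' else 0 := by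
    let F : (s : Fin n) → ((t : Fin n) → t > s → ℝ) → ℝ := fun s ih =>
      R s - ρ + ∑ s', if h : s' > s then P s s' * ih s' h else 0
    have wf : WellFounded (fun a b : Fin n => a > b) := wellFounded_gt
    refine ⟨wf.fix F, fun s => ?_⟩
    rw [wf.fix_eq]
    simp only [F, gt_iff_lt, dite_eq_ite]
  obtain ⟨W, hW⟩ := hW
  have h0 : π 0 ≠ 0 := by
    intro h0
    have hz : ∀ m : ℕ, ∀ j : Fin n, j.val = m → π j = 0 := by
      intro m
      induction m using Nat.strong_induction_on with
      | _ m ih =>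
        intro j hj
        by_cases hj0 : j = 0
        · rw [hj0, h0]
        · rw [← hπ_stat j]
          refine Finset.sum_eq_zero fun i _ => ?_
          rcases lt_or_ge i j with h | h
          · rw [ih i.val (by rw [← hj]; exact h) i rfl, zero_mul]
          · rw [hP_typeB i j hj0 h, mul_zero]
    have : ∑ j, π j = 0 := Finset.sum_eq_zero fun j _ => hz _ j rfl
    linarith
  let V : Fin n → ℝ := fun s => if s = 0 then 0 else W s
  have hV0 : V 0 = 0 := by simp [V]
  have hVW : ∀ s, s ≠ 0 → V s = W s := fun s hs => by simp [V, hs]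
  have hsum : ∀ s, W s = R s - ρ + ∑ s', P s s' * V s' := by
    intro s
    rw [hW s]
    congr 1
    refine Finset.sum_congr rfl fun t _ => ?_
    by_cases ht : t = 0
    · subst ht
      simp [hV0]
    · rw [hVW t ht]
      split_ifs with h
      · rfl
      · rw [hP_typeB s t ht (not_lt.mp h), zero_mul]
  have hsplit : ∑ s, π s * W s = ∑ s, π s * V s := by
    have e1 : ∑ s, π s * ∑ s', P s s' * V s' = ∑ s, π s * V s := by
      simp only [Finset.mul_sum]
      rw [Finset.sum_comm]
      refine Finset.sum_congr rfl fun j _ => ?_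
      rw [← hπ_stat j, Finset.sum_mul]
      exact Finset.sum_congr rfl fun i _ => by ring
    have e2 : ∑ s, π s * W s
        = ∑ s, π s * R s - (∑ s, π s) * ρ + ∑ s, π s * ∑ s', P s s' * V s' := by
      rw [Finset.sum_mul, ← Finset.sum_sub_distrib, ← Finset.sum_add_distrib]
      exact Finset.sum_congr rfl fun s _ => by rw [hsum s]; ring
    rw [e2, e1, hπ_sum, hρ]; ring
  have hd : ∑ s, π s * (W s - V s) = π 0 * W 0 := by
    rw [Finset.sum_eq_single 0]
    · rw [hV0, sub_zero]
    · intro s _ hs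
      rw [hVW s hs, sub_self, mul_zero]
    · simp
  have hW0 : W 0 = 0 := by
    have : π 0 * W 0 = 0 := by
      rw [← hd]
      simp only [mul_sub, Finset.sum_sub_distrib]
      rw [hsplit, sub_self]
    exact (mul_eq_zero.mp this).resolve_left h0
  refine ⟨V, hV0, fun s => ?_⟩
  rw [← hsum s]
  by_cases hs : s = 0
  · rw [hs, hV0, hW0]
  · exact hVW s hs
end
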